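/- Let q : ℝ → ℂ be 1-periodic, integrable on [0,1], with Fourier coefficients q_n = ∫₀¹ q(x)e^{-2πinx}dx satisfying q_n = 0 for all integers n ≤ 0. For μ ∈ ℂ, let θ and φ be solutions of −y'' + qy = μ²y in the integral (Carathéodory) sense satisfying the initial conditions θ(0) = 1, θ'(0) = 0 and φ(0) = 0, φ'(0) = 1. Then the Hill discriminant satisfies φ'(1) + θ(1) = 2cos(μ) for every μ ∈ ℂ. -/

import Mathlib

open MeasureTheory Filter

noncomputable section

/-- The `n`-th Fourier coefficient of `q` on `[0,1]`: `∫₀¹ q(x) e^{-2πinx} dx`. -/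
def fCoeff (q : ℝ → ℂ) (n : ℤ) : ℂ :=
  ∫ x in (0:ℝ)..1, q x * Complex.exp (-(2 * (Real.pi : ℂ) * Complex.I * (n : ℂ) * (x : ℂ)))

/-- `q` is 1-periodic, integrable on `[0,1]`, and all its Fourier coefficients with
nonpositive index vanish (the class `L¹₊`). -/
def MemL1Plus (q : ℝ → ℂ) : Prop :=
  (∀ x : ℝ, q (x + 1) = q x) ∧ IntervalIntegrable q volume 0 1 ∧
    ∀ n : ℤ, n ≤ 0 → fCoeff q n = 0

/-- `y` is a solution of `-y'' + q y = lam y` in the integral (Carathéodory) sense. -/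
def IsCaraSol (q : ℝ → ℂ) (lam : ℂ) (y : ℝ → ℂ) : Prop :=
  Differentiable ℝ y ∧
    ∀ x : ℝ, deriv y x = deriv y 0 + ∫ s in (0:ℝ)..x, (q s - lam) * y s

/-- `y` is an eigenfunction of `L_t(q)` with eigenvalue `lam`. -/
def IsEigenfun (q : ℝ → ℂ) (t lam : ℂ) (y : ℝ → ℂ) : Prop :=
  IsCaraSol q lam y ∧ (∃ x : ℝ, y x ≠ 0) ∧
    y 1 = Complex.exp (Complex.I * t) * y 0 ∧
    deriv y 1 = Complex.exp (Complex.I * t) * deriv y 0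

/-- A complex-valued interval integral is absolutely continuous as a function of its upper
limit. -/
theorem absolutelyContinuousOnInterval_intervalIntegral_complex {f : ℝ → ℂ} {a b c : ℝ}
    (h : IntervalIntegrable f volume a b) (hc : c ∈ Set.uIcc a b) :
    AbsolutelyContinuousOnInterval (fun x ↦ ∫ v in c..x, f v) a b := by
  have key := h.norm.absolutelyContinuousOnInterval_intervalIntegral hc
  rw [absolutelyContinuousOnInterval_iff] at key ⊢
  intro ε hε
  obtain ⟨δ, hδ, H⟩ := key ε hε
  refine ⟨δ, hδ, fun E hE hlen ↦ lt_of_le_of_lt (Finset.sum_le_sum fun i hi ↦ ?_) (H E hE hlen)⟩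
  have hx := (hE.1 i hi).1
  have hy := (hE.1 i hi).2
  have hii : ∀ x ∈ Set.uIcc a b, ∀ y ∈ Set.uIcc a b, IntervalIntegrable f volume x y :=
    fun x hx y hy ↦ h.mono_set (Set.uIcc_subset_uIcc hx hy)
  rw [dist_eq_norm, Real.dist_eq,
    intervalIntegral.integral_interval_sub_left (hii _ hc _ hx) (hii _ hc _ hy),
    intervalIntegral.integral_interval_sub_left (hii _ hc _ hx).norm (hii _ hc _ hy).norm]
  exact intervalIntegral.norm_integral_le_abs_integral_norm

/-- `f` is, on `[0,1]`, a primitive of the integrable function `f'`. -/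
structure IsPrimitive (f f' : ℝ → ℂ) : Prop where
  integrable : IntervalIntegrable f' volume 0 1
  eq_add_integral : ∀ x ∈ Set.Icc (0:ℝ) 1, f x = f 0 + ∫ s in (0:ℝ)..x, f' s

namespace IsPrimitive

variable {f f' g g' : ℝ → ℂ}

theorem integrable_to (hf : IsPrimitive f f') {x : ℝ} (hx : x ∈ Set.Icc (0:ℝ) 1) :
    IntervalIntegrable f' volume 0 x :=
  hf.integrable.mono_set (by
    rw [Set.uIcc_of_le hx.1, Set.uIcc_of_le zero_le_one]; exact Set.Icc_subset_Icc_right hx.2)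

theorem continuousOn (hf : IsPrimitive f f') : ContinuousOn f (Set.Icc 0 1) := by
  have h := intervalIntegral.continuousOn_primitive_interval (f := f') (μ := volume)
    (a := 0) (b := 1) (by
      rw [Set.uIcc_of_le zero_le_one]
      exact (intervalIntegrable_iff_integrableOn_Icc_of_le zero_le_one).1 hf.integrable)
  rw [Set.uIcc_of_le zero_le_one] at h
  exact (continuousOn_const.add h).congr fun x hx ↦ hf.eq_add_integral x hx

theorem of_hasDerivAt (h : ∀ x, HasDerivAt f (f' x) x) (hc : ContinuousOn f' (Set.Icc 0 1)) :
    IsPrimitive f f' := by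
  have hi : IntervalIntegrable f' volume 0 1 := by
    apply ContinuousOn.intervalIntegrable
    rwa [Set.uIcc_of_le zero_le_one]
  refine ⟨hi, fun x hx ↦ ?_⟩
  rw [intervalIntegral.integral_eq_sub_of_hasDerivAt (fun y _ ↦ h y)
    (hi.mono_set (by
      rw [Set.uIcc_of_le hx.1, Set.uIcc_of_le zero_le_one]
      exact Set.Icc_subset_Icc_right hx.2))]
  ring

theorem congr (hf : IsPrimitive f f') (h : Set.EqOn f g (Set.Icc 0 1))
    (h' : Set.EqOn f' g' (Set.Icc 0 1)) : IsPrimitive g g' := by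
  refine ⟨hf.integrable.congr ?_, fun x hx ↦ ?_⟩
  · intro x hx
    rw [Set.uIoc_of_le zero_le_one] at hx
    exact h' ⟨hx.1.le, hx.2⟩
  · rw [← h hx, ← h (Set.left_mem_Icc.2 zero_le_one), hf.eq_add_integral x hx]
    congr 1
    apply intervalIntegral.integral_congr
    intro y hy
    rw [Set.uIcc_of_le hx.1] at hy
    exact h' ⟨hy.1, hy.2.trans hx.2⟩

theorem const (c : ℂ) : IsPrimitive (fun _ ↦ c) (fun _ ↦ 0) :=
  ⟨by simp, by simp⟩

theorem add (hf : IsPrimitive f f') (hg : IsPrimitive g g') :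
    IsPrimitive (fun x ↦ f x + g x) (fun x ↦ f' x + g' x) := by
  refine ⟨hf.integrable.add hg.integrable, fun x hx ↦ ?_⟩
  rw [hf.eq_add_integral x hx, hg.eq_add_integral x hx,
    intervalIntegral.integral_add (hf.integrable_to hx) (hg.integrable_to hx)]
  ring

theorem const_mul (c : ℂ) (hf : IsPrimitive f f') :
    IsPrimitive (fun x ↦ c * f x) (fun x ↦ c * f' x) := by
  refine ⟨hf.integrable.const_mul c, fun x hx ↦ ?_⟩
  rw [hf.eq_add_integral x hx, intervalIntegral.integral_const_mul]
  ring

theorem sub (hf : IsPrimitive f f') (hg : IsPrimitive g g') :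
    IsPrimitive (fun x ↦ f x - g x) (fun x ↦ f' x - g' x) := by
  refine (hf.add (hg.const_mul (-1))).congr (fun x _ ↦ ?_) (fun x _ ↦ ?_) <;> ring

theorem mul (hf : IsPrimitive f f') (hg : IsPrimitive g g') :
    IsPrimitive (fun x ↦ f x * g x) (fun x ↦ f' x * g x + f x * g' x) := by
  have hu : Set.uIcc (0:ℝ) 1 = Set.Icc 0 1 := Set.uIcc_of_le zero_le_one
  have h0 : (0:ℝ) ∈ Set.uIcc (0:ℝ) 1 := Set.left_mem_uIcc
  have hint : IntervalIntegrable (fun x ↦ f' x * g x + f x * g' x) volume 0 1 :=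
    (hf.integrable.mul_continuousOn (by rw [hu]; exact hg.continuousOn)).add
      (hg.integrable.continuousOn_mul (by rw [hu]; exact hf.continuousOn))
  refine ⟨hint, ?_⟩
  set F : ℝ → ℂ := fun x ↦ f 0 + ∫ s in (0:ℝ)..x, f' s with hF
  set G : ℝ → ℂ := fun x ↦ g 0 + ∫ s in (0:ℝ)..x, g' s with hG
  have hc (c : ℂ) : AbsolutelyContinuousOnInterval (fun _ : ℝ ↦ c) 0 1 :=
    (contDiffOn_const (c := c)).absolutelyContinuousOnInterval
  have hFac : AbsolutelyContinuousOnInterval F 0 1 :=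
    (hc (f 0)).fun_add (absolutelyContinuousOnInterval_intervalIntegral_complex hf.integrable h0)
  have hGac : AbsolutelyContinuousOnInterval G 0 1 :=
    (hc (g 0)).fun_add (absolutelyContinuousOnInterval_intervalIntegral_complex hg.integrable h0)
  have hD : AbsolutelyContinuousOnInterval
      (fun x ↦ F x * G x - ∫ s in (0:ℝ)..x, (f' s * g s + f s * g' s)) 0 1 :=
    (hFac.fun_smul hGac).fun_sub
      (absolutelyContinuousOnInterval_intervalIntegral_complex hint h0)
  obtain ⟨C, hC⟩ := hD.const_of_ae_hasDerivAt_zero (by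
    filter_upwards [hf.integrable.ae_hasDerivAt_integral, hg.integrable.ae_hasDerivAt_integral,
      hint.ae_hasDerivAt_integral] with x h1 h2 h3 hx
    have hx' := hx
    rw [hu] at hx'
    have d1 : HasDerivAt F (f' x) x := (h1 hx 0 h0).const_add _
    have d2 : HasDerivAt G (g' x) x := (h2 hx 0 h0).const_add _
    have := (d1.mul d2).sub (h3 hx 0 h0)
    refine this.congr_deriv ?_
    rw [hf.eq_add_integral x hx', hg.eq_add_integral x hx']
    simp only [hF, hG]
    ring)
  intro x hx
  have e0 := hC 0 h0
  have e1 := hC x (by rwa [hu])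
  simp only [hF, hG, ← hf.eq_add_integral x hx, ← hg.eq_add_integral x hx] at e0 e1
  simp only [intervalIntegral.integral_same, add_zero, sub_zero] at e0
  rw [e0, ← e1]
  ring

end IsPrimitive

theorem fourierKernel_intervalIntegrable {g : ℝ → ℂ} (hg : IntervalIntegrable g volume 0 1)
    (n : ℤ) : IntervalIntegrable
      (fun x : ℝ ↦ g x * Complex.exp (-(2 * (Real.pi : ℂ) * Complex.I * (n : ℂ) * (x : ℂ))))
      volume 0 1 :=
  hg.mul_continuousOn (by fun_prop)

theorem fCoeff_congr {f g : ℝ → ℂ} (h : Set.EqOn f g (Set.Icc 0 1)) (n : ℤ) :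
    fCoeff f n = fCoeff g n := by
  apply intervalIntegral.integral_congr
  intro x hx
  rw [Set.uIcc_of_le zero_le_one] at hx
  simp only [h hx]

theorem fCoeff_add {f g : ℝ → ℂ} (hf : IntervalIntegrable f volume 0 1)
    (hg : IntervalIntegrable g volume 0 1) (n : ℤ) :
    fCoeff (fun x ↦ f x + g x) n = fCoeff f n + fCoeff g n := by
  simp only [fCoeff, add_mul]
  exact intervalIntegral.integral_add (fourierKernel_intervalIntegrable hf n)
    (fourierKernel_intervalIntegrable hg n)

theorem fCoeff_const_mul (c : ℂ) (f : ℝ → ℂ) (n : ℤ) :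
    fCoeff (fun x ↦ c * f x) n = c * fCoeff f n := by
  simp only [fCoeff, mul_assoc]
  exact intervalIntegral.integral_const_mul _ _

theorem fCoeff_sub {f g : ℝ → ℂ} (hf : IntervalIntegrable f volume 0 1)
    (hg : IntervalIntegrable g volume 0 1) (n : ℤ) :
    fCoeff (fun x ↦ f x - g x) n = fCoeff f n - fCoeff g n := by
  have h := fCoeff_add hf (hg.const_mul (-1)) n
  rw [fCoeff_const_mul] at h
  simp only [neg_one_mul, ← sub_eq_add_neg] at h
  exact h

theorem fCoeff_zero (f : ℝ → ℂ) : fCoeff f 0 = ∫ x in (0:ℝ)..1, f x := by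
  simp [fCoeff]

theorem exp_two_pi_int (n : ℤ) : Complex.exp (2 * (Real.pi : ℂ) * Complex.I * n) = 1 :=
  Complex.exp_eq_one_iff.2 ⟨n, by ring⟩

theorem IsPrimitive.fCoeff_deriv {f f' : ℝ → ℂ} (hf : IsPrimitive f f') (h01 : f 0 = f 1)
    (n : ℤ) : fCoeff f' n = 2 * (Real.pi : ℂ) * Complex.I * n * fCoeff f n := by
  set c : ℂ := 2 * (Real.pi : ℂ) * Complex.I * n with hc
  have he : IsPrimitive (fun x : ℝ ↦ Complex.exp (-(c * x)))
      (fun x : ℝ ↦ -c * Complex.exp (-(c * x))) := by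
    refine IsPrimitive.of_hasDerivAt (fun x ↦ ?_) (by fun_prop)
    have h : HasDerivAt (fun x : ℝ ↦ -(c * (x : ℂ))) (-(c * 1)) x :=
      (((hasDerivAt_id x).ofReal_comp).const_mul c).neg
    exact h.cexp.congr_deriv (by ring)
  have h := (hf.mul he).eq_add_integral 1 (by simp)
  have h1 : Complex.exp (-(c * (1:ℝ))) = 1 := by
    rw [hc, Complex.exp_neg, Complex.ofReal_one, mul_one, exp_two_pi_int, inv_one]
  have hint : IntervalIntegrable f volume 0 1 := by
    apply ContinuousOn.intervalIntegrable
    rw [Set.uIcc_of_le zero_le_one]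
    exact hf.continuousOn
  rw [intervalIntegral.integral_add (fourierKernel_intervalIntegrable hf.integrable n)
    (hint.mul_continuousOn (by fun_prop)), h1, ← h01] at h
  have h2 : ∫ x in (0:ℝ)..1, f x * (-c * Complex.exp (-(c * x))) = -c * fCoeff f n := by
    rw [fCoeff, ← intervalIntegral.integral_const_mul]
    congr 1
    ext x
    ring
  rw [h2] at h
  simp only [Complex.ofReal_zero, mul_zero, neg_zero, Complex.exp_zero, mul_one] at h
  change f 0 = f 0 + (fCoeff f' n + -c * fCoeff f n) at h
  linear_combination -h

theorem fCoeff_eq_fourierCoeffOn (f : ℝ → ℂ) (n : ℤ) :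
    fCoeff f n = fourierCoeffOn (zero_lt_one (α := ℝ)) f n := by
  rw [fourierCoeffOn_eq_integral, fCoeff]
  simp only [sub_zero, div_one, one_smul]
  congr 1
  ext x
  rw [fourier_coe_apply, smul_eq_mul, mul_comm]
  congr 2
  push_cast
  ring

/-- A continuous periodic function whose nonconstant Fourier coefficients vanish is constant. -/
theorem eq_fCoeff_zero_of_fCoeff_eq_zero {w : ℝ → ℂ} (hw : ContinuousOn w (Set.Icc 0 1))
    (h01 : w 0 = w 1) (h : ∀ n : ℤ, n ≠ 0 → fCoeff w n = 0) :
    ∀ x ∈ Set.Icc (0:ℝ) 1, w x = fCoeff w 0 := by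
  have : Fact ((0:ℝ) < 1) := ⟨zero_lt_one⟩
  let W : C(AddCircle (1:ℝ), ℂ) :=
    ⟨AddCircle.liftIco 1 0 w, AddCircle.liftIco_zero_continuous h01 hw⟩
  have hW : ∀ n, fourierCoeff W n = fCoeff w n := by
    intro n
    have := fourierCoeff_liftIco_eq (T := 1) (a := 0) w n
    rw [fCoeff_eq_fourierCoeffOn]
    simp only [zero_add] at this
    exact this
  have hs : Summable (fourierCoeff W) :=
    summable_of_ne_finset_zero (s := {0}) fun n hn ↦ by
      rw [hW]; exact h n (by simpa using hn)
  have hI : ∀ x ∈ Set.Ico (0:ℝ) 1, w x = fCoeff w 0 := by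
    intro x hx
    have h1 := has_pointwise_sum_fourier_series_of_summable hs (x : AddCircle (1:ℝ))
    have h2 : HasSum (fun i ↦ fourierCoeff W i • fourier i (x : AddCircle (1:ℝ)))
        (fourierCoeff W 0 • fourier 0 (x : AddCircle (1:ℝ))) :=
      hasSum_single 0 fun n hn ↦ by rw [hW, h n hn, zero_smul]
    have h3 := h1.unique h2
    rw [hW, fourier_zero, smul_eq_mul, mul_one] at h3
    rw [← h3]
    exact (AddCircle.liftIco_coe_apply (by simpa using hx)).symm
  intro x hx
  rcases hx.2.eq_or_lt with rfl | hlt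
  · rw [← h01]; exact hI 0 (by simp)
  · exact hI x ⟨hx.1, hlt⟩

/-- The absolutely convergent Fourier series with nonnegative frequencies and coefficients `a`. -/
def fourierSum (a : ℕ → ℂ) (x : ℝ) : ℂ :=
  ∑' k : ℕ, a k * Complex.exp (2 * (Real.pi : ℂ) * Complex.I * (k : ℂ) * (x : ℂ))

theorem norm_fourierTerm (z : ℂ) (k : ℕ) (x : ℝ) :
    ‖z * Complex.exp (2 * (Real.pi : ℂ) * Complex.I * (k : ℂ) * (x : ℂ))‖ = ‖z‖ := by
  have : 2 * (Real.pi : ℂ) * Complex.I * (k : ℂ) * (x : ℂ)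
      = ((2 * Real.pi * k * x : ℝ) : ℂ) * Complex.I := by push_cast; ring
  rw [norm_mul, this, Complex.norm_exp_ofReal_mul_I, mul_one]

theorem continuous_fourierSum {a : ℕ → ℂ} (ha : Summable fun k ↦ ‖a k‖) :
    Continuous (fourierSum a) :=
  continuous_tsum (fun k ↦ by fun_prop) ha fun k x ↦ (norm_fourierTerm (a k) k x).le

theorem fourierSum_zero_eq_one (a : ℕ → ℂ) : fourierSum a 0 = fourierSum a 1 := by
  refine tsum_congr fun k ↦ ?_
  have := exp_two_pi_int k
  push_cast at this
  rw [Complex.ofReal_zero, Complex.ofReal_one, mul_one, this, mul_zero, Complex.exp_zero]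

theorem hasSum_fCoeff_mul_fourierSum {a : ℕ → ℂ} (ha : Summable fun k ↦ ‖a k‖) {g : ℝ → ℂ}
    (hg : IntervalIntegrable g volume 0 1) (n : ℤ) :
    HasSum (fun k : ℕ ↦ a k * fCoeff g (n - k)) (fCoeff (fun x ↦ g x * fourierSum a x) n) := by
  have key : ∀ k : ℕ, a k * fCoeff g (n - k) = ∫ x in (0:ℝ)..1,
      (g x * Complex.exp (-(2 * (Real.pi : ℂ) * Complex.I * (n : ℂ) * (x : ℂ)))) *
        (a k * Complex.exp (2 * (Real.pi : ℂ) * Complex.I * (k : ℂ) * (x : ℂ))) := by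
    intro k
    rw [fCoeff, ← intervalIntegral.integral_const_mul]
    congr 1
    ext x
    have : -(2 * (Real.pi : ℂ) * Complex.I * ((n - k : ℤ) : ℂ) * (x : ℂ))
        = -(2 * (Real.pi : ℂ) * Complex.I * (n : ℂ) * (x : ℂ))
          + 2 * (Real.pi : ℂ) * Complex.I * (k : ℂ) * (x : ℂ) := by push_cast; ring
    rw [this, Complex.exp_add]
    ring
  have hG := fourierKernel_intervalIntegrable hg n
  set G : ℝ → ℂ :=
    fun x ↦ g x * Complex.exp (-(2 * (Real.pi : ℂ) * Complex.I * (n : ℂ) * (x : ℂ))) with hGdef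
  have hval : fCoeff (fun x ↦ g x * fourierSum a x) n
      = ∫ x in (0:ℝ)..1, G x * fourierSum a x := by
    rw [fCoeff]
    congr 1
    ext x
    simp only [hGdef]
    ring
  simp only [key]
  rw [hval]
  refine intervalIntegral.hasSum_integral_of_dominated_convergence
    (fun k x ↦ ‖G x‖ * ‖a k‖) (fun k ↦ ?_) (fun k ↦ ?_) ?_ ?_ ?_
  · exact (hG.mul_continuousOn (by fun_prop)).def'.aestronglyMeasurable
  · exact Eventually.of_forall fun x _ ↦ by
      rw [norm_mul, norm_fourierTerm]
  · exact Eventually.of_forall fun x _ ↦ ha.mul_left _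
  · simp only [tsum_mul_left]
    exact hG.norm.mul_const _
  · refine Eventually.of_forall fun x _ ↦ HasSum.mul_left _ (Summable.hasSum ?_)
    exact Summable.of_norm (by simpa only [norm_fourierTerm] using ha)

theorem fCoeff_one (n : ℤ) : fCoeff (fun _ ↦ 1) n = if n = 0 then 1 else 0 := by
  split_ifs with h
  · subst h; rw [fCoeff_zero]; simp
  · have := (IsPrimitive.const 1).fCoeff_deriv rfl n
    have h0 : fCoeff (fun _ ↦ 0) n = 0 := by simp [fCoeff]
    rw [h0] at this
    have hn : (n : ℂ) ≠ 0 := by exact_mod_cast h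
    have hne : 2 * (Real.pi : ℂ) * Complex.I * n ≠ 0 :=
      mul_ne_zero Complex.two_pi_I_ne_zero hn
    exact (mul_eq_zero.1 this.symm).resolve_left hne

theorem fCoeff_fourierSum {a : ℕ → ℂ} (ha : Summable fun k ↦ ‖a k‖) (n : ℤ) :
    HasSum (fun k : ℕ ↦ if n = k then a k else 0) (fCoeff (fourierSum a) n) := by
  have h := hasSum_fCoeff_mul_fourierSum ha (g := fun _ ↦ 1) (by simp) n
  simpa only [fCoeff_one, one_mul, sub_eq_zero, mul_ite, mul_one, mul_zero] using h

theorem fCoeff_fourierSum_natCast {a : ℕ → ℂ} (ha : Summable fun k ↦ ‖a k‖) (n : ℕ) :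
    fCoeff (fourierSum a) n = a n := by
  refine (fCoeff_fourierSum ha n).unique ?_
  convert! hasSum_single (f := fun k : ℕ ↦ if (n : ℤ) = k then a k else 0) n ?_ using 1
  · simp
  · intro k hk
    rw [if_neg]
    exact_mod_cast hk.symm

theorem fCoeff_fourierSum_of_neg {a : ℕ → ℂ} (ha : Summable fun k ↦ ‖a k‖) {n : ℤ}
    (hn : n < 0) : fCoeff (fourierSum a) n = 0 := by
  refine (fCoeff_fourierSum ha n).unique ?_
  convert! hasSum_zero using 2 with k
  rw [if_neg (by lia)]

theorem norm_fCoeff_le {q : ℝ → ℂ} (n : ℤ) :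
    ‖fCoeff q n‖ ≤ ∫ x in (0:ℝ)..1, ‖q x‖ := by
  refine (intervalIntegral.norm_integral_le_integral_norm zero_le_one).trans_eq ?_
  congr 1
  ext x
  have : -(2 * (Real.pi : ℂ) * Complex.I * (n : ℂ) * (x : ℂ))
      = ((-(2 * Real.pi * n * x) : ℝ) : ℂ) * Complex.I := by push_cast; ring
  rw [norm_mul, this, Complex.norm_exp_ofReal_mul_I, mul_one]

/-- A nonnegative sequence each of whose terms is at most `K / n ^ 2` times the sum of the
preceding ones is summable. -/
theorem summable_of_le_div_sq_mul_sum {s : ℕ → ℝ} (hs : ∀ n, 0 ≤ s n) {K : ℝ} (hK : 0 ≤ K)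
    (h : ∀ n : ℕ, s (n + 1) ≤ K / ((n : ℝ) + 1) ^ 2 * ∑ k ∈ Finset.range (n + 1), s k) :
    Summable s := by
  have hsum : Summable fun n : ℕ ↦ K / ((n : ℝ) + 1) ^ 2 := by
    have h2 := (summable_nat_add_iff 1).2 (Real.summable_one_div_nat_pow.2 one_lt_two)
    simpa [div_eq_mul_inv] using h2.mul_left K
  have hb : ∀ n : ℕ, ∑ k ∈ Finset.range (n + 1), s k
      ≤ s 0 * Real.exp (∑ k ∈ Finset.range n, K / ((k : ℝ) + 1) ^ 2) := by
    intro n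
    induction n with
    | zero => simp
    | succ n ih =>
      rw [Finset.sum_range_succ, Finset.sum_range_succ (fun k : ℕ ↦ K / ((k : ℝ) + 1) ^ 2),
        Real.exp_add, ← mul_assoc]
      have h0 : 0 ≤ ∑ k ∈ Finset.range (n + 1), s k := Finset.sum_nonneg fun k _ ↦ hs k
      calc (∑ k ∈ Finset.range (n + 1), s k) + s (n + 1)
          ≤ (∑ k ∈ Finset.range (n + 1), s k) * (K / ((n : ℝ) + 1) ^ 2 + 1) := by
            linarith [h n]
        _ ≤ _ := mul_le_mul ih (Real.add_one_le_exp _) (by positivity)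
            (mul_nonneg (hs 0) (Real.exp_pos _).le)
  refine summable_of_sum_range_le (c := s 0 * Real.exp (∑' k : ℕ, K / ((k : ℝ) + 1) ^ 2))
    hs fun n ↦ ?_
  calc ∑ k ∈ Finset.range n, s k ≤ ∑ k ∈ Finset.range (n + 1), s k :=
        Finset.sum_le_sum_of_subset_of_nonneg (Finset.range_mono n.le_succ) fun k _ _ ↦ hs k
    _ ≤ _ := hb n
    _ ≤ _ := mul_le_mul_of_nonneg_left (Real.exp_le_exp.2
        (hsum.sum_le_tsum _ fun k _ ↦ by positivity)) (hs 0)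

theorem exists_norm_div_le (μ : ℂ) : ∃ C : ℝ, ∀ n : ℕ, ‖(n : ℂ) / (μ + Real.pi * n)‖ ≤ C := by
  have hpi : (Real.pi : ℂ) ≠ 0 := by exact_mod_cast Real.pi_ne_zero
  have h := ((tendsto_natCast_div_add_atTop (𝕜 := ℂ) (μ / Real.pi)).norm).bddAbove_range
  obtain ⟨C, hC⟩ := h
  refine ⟨‖(Real.pi : ℂ)⁻¹‖ * C, fun n ↦ ?_⟩
  have : (n : ℂ) / (μ + Real.pi * n) = (Real.pi : ℂ)⁻¹ * (n / (n + μ / Real.pi)) := by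
    rw [inv_mul_eq_div, div_div]
    congr 1
    field_simp
    ring
  rw [this, norm_mul]
  exact mul_le_mul_of_nonneg_left (hC ⟨n, rfl⟩) (norm_nonneg _)

/-- The Fourier coefficients of the periodic factor of the Floquet solution with multiplier
`exp (I * μ)`. -/
def floquetCoeff (q : ℝ → ℂ) (μ : ℂ) : ℕ → ℂ
  | 0 => 1
  | n + 1 => -(∑ k : Fin (n + 1), floquetCoeff q μ k * fCoeff q (((n + 1 : ℕ) : ℤ) - (k : ℕ))) /
      (4 * Real.pi * (n + 1 : ℕ) * (μ + Real.pi * (n + 1 : ℕ)))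
  decreasing_by exact k.2

theorem floquetCoeff_succ (q : ℝ → ℂ) (μ : ℂ) (n : ℕ) :
    floquetCoeff q μ (n + 1) =
      -(∑ k ∈ Finset.range (n + 1), floquetCoeff q μ k * fCoeff q (((n + 1 : ℕ) : ℤ) - k)) /
      (4 * Real.pi * (n + 1 : ℕ) * (μ + Real.pi * (n + 1 : ℕ))) := by
  rw [floquetCoeff, ← Fin.sum_univ_eq_sum_range
    (fun k ↦ floquetCoeff q μ k * fCoeff q (((n + 1 : ℕ) : ℤ) - k))]

theorem sum_floquetCoeff_mul_fCoeff (q : ℝ → ℂ) {μ : ℂ}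
    (hμ : ∀ n : ℕ, n ≠ 0 → μ + Real.pi * n ≠ 0) (n : ℕ) :
    ∑ k ∈ Finset.range n, floquetCoeff q μ k * fCoeff q ((n : ℤ) - k) =
      -(4 * Real.pi * n * (μ + Real.pi * n)) * floquetCoeff q μ n := by
  cases n with
  | zero => simp
  | succ n =>
    have hpi : (Real.pi : ℂ) ≠ 0 := by exact_mod_cast Real.pi_ne_zero
    have hn : ((n + 1 : ℕ) : ℂ) ≠ 0 := by exact_mod_cast n.succ_ne_zero
    have hd : 4 * (Real.pi : ℂ) * (n + 1 : ℕ) * (μ + Real.pi * (n + 1 : ℕ)) ≠ 0 :=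
      mul_ne_zero (mul_ne_zero (mul_ne_zero (by norm_num) hpi) hn) (hμ _ n.succ_ne_zero)
    rw [floquetCoeff_succ, neg_mul, mul_div_cancel₀ _ hd, neg_neg]

theorem summable_norm_floquetCoeff (q : ℝ → ℂ) (μ : ℂ) :
    Summable fun n ↦ ‖floquetCoeff q μ n‖ := by
  obtain ⟨C, hC⟩ := exists_norm_div_le μ
  have hC0 : 0 ≤ C := (norm_nonneg _).trans (hC 0)
  set M : ℝ := ∫ x in (0:ℝ)..1, ‖q x‖ with hM
  have hM0 : 0 ≤ M := (norm_nonneg _).trans (norm_fCoeff_le (q := q) 0)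
  refine summable_of_le_div_sq_mul_sum (K := C * M) (fun n ↦ norm_nonneg _) (by positivity)
    fun n ↦ ?_
  have hS : ‖∑ k ∈ Finset.range (n + 1),
      floquetCoeff q μ k * fCoeff q (((n + 1 : ℕ) : ℤ) - k)‖
      ≤ M * ∑ k ∈ Finset.range (n + 1), ‖floquetCoeff q μ k‖ := by
    refine (norm_sum_le _ _).trans ?_
    rw [Finset.mul_sum]
    refine Finset.sum_le_sum fun k _ ↦ ?_
    rw [norm_mul, mul_comm]
    exact mul_le_mul_of_nonneg_right (norm_fCoeff_le _) (norm_nonneg _)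
  have hn : ((n + 1 : ℕ) : ℂ) ≠ 0 := by exact_mod_cast n.succ_ne_zero
  have hD : ‖(4 * (Real.pi : ℂ) * (n + 1 : ℕ) * (μ + Real.pi * (n + 1 : ℕ)))⁻¹‖
      ≤ C / ((n : ℝ) + 1) ^ 2 := by
    have e : (4 * (Real.pi : ℂ) * (n + 1 : ℕ) * (μ + Real.pi * (n + 1 : ℕ)))⁻¹
        = (4 * (Real.pi : ℂ))⁻¹ *
          (((n + 1 : ℕ) : ℂ) / (μ + Real.pi * (n + 1 : ℕ)) / ((n + 1 : ℕ) : ℂ) ^ 2) := by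
      rw [mul_inv, mul_inv]
      field_simp
    have h4 : ‖(4 * (Real.pi : ℂ))⁻¹‖ ≤ 1 := by
      rw [norm_inv, norm_mul, Complex.norm_real, Real.norm_of_nonneg Real.pi_pos.le]
      refine inv_le_one_of_one_le₀ ?_
      have := Real.pi_gt_three
      norm_num
      linarith
    have hnn : ‖((n + 1 : ℕ) : ℂ) ^ 2‖ = ((n : ℝ) + 1) ^ 2 := by
      rw [norm_pow, Complex.norm_natCast]
      push_cast
      ring
    rw [e, norm_mul, norm_div, hnn]
    refine (mul_le_of_le_one_left (by positivity) h4).trans ?_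
    gcongr
    exact hC (n + 1)
  rw [floquetCoeff_succ, div_eq_mul_inv, norm_mul, norm_neg]
  calc _ ≤ (M * ∑ k ∈ Finset.range (n + 1), ‖floquetCoeff q μ k‖) * (C / ((n : ℝ) + 1) ^ 2) :=
        mul_le_mul hS hD (norm_nonneg _) (by positivity)
    _ = _ := by ring

theorem fCoeff_mul_fourierSum_floquetCoeff {q : ℝ → ℂ} (hq : MemL1Plus q) {μ : ℂ}
    (hμ : ∀ n : ℕ, n ≠ 0 → μ + Real.pi * n ≠ 0) (n : ℤ) :
    fCoeff (fun x ↦ q x * fourierSum (floquetCoeff q μ) x) n =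
      -(4 * Real.pi * n * (μ + Real.pi * n)) * fCoeff (fourierSum (floquetCoeff q μ)) n := by
  have ha := summable_norm_floquetCoeff q μ
  have h := hasSum_fCoeff_mul_fourierSum ha hq.2.1 n
  rcases lt_or_ge n 0 with hn | hn
  · rw [fCoeff_fourierSum_of_neg ha hn, mul_zero]
    refine h.unique ?_
    convert! hasSum_zero using 2 with k
    rw [hq.2.2 _ (by lia), mul_zero]
  · lift n to ℕ using hn
    rw [fCoeff_fourierSum_natCast ha]
    have h2 := sum_floquetCoeff_mul_fCoeff q hμ n
    rw [Int.cast_natCast, ← h2]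
    refine h.unique (hasSum_sum_of_ne_finset_zero fun k hk ↦ ?_)
    rw [Finset.mem_range, not_lt] at hk
    rw [hq.2.2 _ (by lia), mul_zero]

/-- A solution on `[0,1]` that is multiplied by `exp (I * μ)` over the period. -/
theorem exists_floquet_solution {q : ℝ → ℂ} (hq : MemL1Plus q) {μ : ℂ}
    (hμ : ∀ n : ℕ, n ≠ 0 → μ + Real.pi * n ≠ 0) :
    ∃ y y' : ℝ → ℂ, IsPrimitive y y' ∧ IsPrimitive y' (fun x ↦ (q x - μ ^ 2) * y x) ∧
      y 1 = Complex.exp (Complex.I * μ) * y 0 ∧ y' 1 = Complex.exp (Complex.I * μ) * y' 0 ∧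
      ∃ x ∈ Set.Icc (0:ℝ) 1, y x ≠ 0 := by
  have ha := summable_norm_floquetCoeff q μ
  set u := fourierSum (floquetCoeff q μ) with hu
  have huc : Continuous u := continuous_fourierSum ha
  have hu01 : u 0 = u 1 := fourierSum_zero_eq_one _
  have hu0 : fCoeff u 0 = 1 := by
    have := fCoeff_fourierSum_natCast ha 0
    rw [Nat.cast_zero] at this
    rw [hu, this, floquetCoeff]
  have hfn := fCoeff_mul_fourierSum_floquetCoeff hq hμ
  rw [← hu] at hfn
  set f : ℝ → ℂ := fun x ↦ q x * u x with hf
  have hfi : IntervalIntegrable f volume 0 1 := hq.2.1.mul_continuousOn huc.continuousOn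
  -- `F` is the periodic primitive of `q u`
  set F : ℝ → ℂ := fun x ↦ ∫ s in (0:ℝ)..x, f s with hF
  have hFp : IsPrimitive F f := ⟨hfi, fun x _ ↦ by simp [hF]⟩
  have hF0 : F 0 = 0 := by simp [hF]
  have hF1 : F 1 = 0 := by
    have := hfn 0
    rw [fCoeff_zero] at this
    simpa [hF] using this
  have hFi : IntervalIntegrable F volume 0 1 := by
    apply ContinuousOn.intervalIntegrable
    rw [Set.uIcc_of_le zero_le_one]
    exact hFp.continuousOn
  have hFn := hFp.fCoeff_deriv (hF0.trans hF1.symm)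
  set c : ℂ := 2 * Complex.I * μ - fCoeff F 0 with hc
  have hui : IntervalIntegrable u volume 0 1 := huc.intervalIntegrable _ _
  -- `G` is the derivative of `u`
  set G : ℝ → ℂ := fun x ↦ F x + c * 1 - 2 * Complex.I * μ * u x with hG
  have hci : IntervalIntegrable (fun _ : ℝ ↦ c * 1) volume 0 1 := by simp
  have hGi : IntervalIntegrable G volume 0 1 := (hFi.add hci).sub (hui.const_mul _)
  have hGn : ∀ n : ℤ, fCoeff G n = 2 * Real.pi * Complex.I * n * fCoeff u n := by
    intro n
    rw [hG, fCoeff_sub (hFi.add hci) (hui.const_mul _), fCoeff_add hFi hci, fCoeff_const_mul,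
      fCoeff_const_mul _ u, fCoeff_one]
    split_ifs with hn
    · subst hn
      rw [hu0, hc]
      push_cast
      ring
    · have hn' : (n : ℂ) ≠ 0 := by exact_mod_cast hn
      have hne : 2 * (Real.pi : ℂ) * Complex.I * n ≠ 0 :=
        mul_ne_zero Complex.two_pi_I_ne_zero hn'
      apply mul_left_cancel₀ hne
      have e : 2 * (Real.pi : ℂ) * Complex.I * n * fCoeff F n
          = -(4 * Real.pi * n * (μ + Real.pi * n)) * fCoeff u n := by
        rw [← hFn, hfn]
      linear_combination e - (4 * Real.pi * n * μ + 4 * Real.pi ^ 2 * n ^ 2) * fCoeff u n *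
        Complex.I_sq
  set H : ℝ → ℂ := fun x ↦ ∫ s in (0:ℝ)..x, G s with hH
  have hHp : IsPrimitive H G := ⟨hGi, fun x _ ↦ by simp [hH]⟩
  have hH0 : H 0 = 0 := by simp [hH]
  have hH1 : H 1 = 0 := by
    have := hGn 0
    rw [fCoeff_zero] at this
    simpa [hH] using this
  have hHi : IntervalIntegrable H volume 0 1 := by
    apply ContinuousOn.intervalIntegrable
    rw [Set.uIcc_of_le zero_le_one]
    exact hHp.continuousOn
  have hHn := hHp.fCoeff_deriv (hH0.trans hH1.symm)
  have hw := eq_fCoeff_zero_of_fCoeff_eq_zero (w := fun x ↦ u x - H x)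
    (huc.continuousOn.sub hHp.continuousOn) (by simp only [hu01, hH0, hH1]) (fun n hn ↦ by
      have hn' : (n : ℂ) ≠ 0 := by exact_mod_cast hn
      have hne : 2 * (Real.pi : ℂ) * Complex.I * n ≠ 0 :=
        mul_ne_zero Complex.two_pi_I_ne_zero hn'
      rw [fCoeff_sub hui hHi, sub_eq_zero]
      exact mul_left_cancel₀ hne ((hGn n).symm.trans (hHn n)))
  have hup : IsPrimitive u G := by
    refine ((IsPrimitive.const (fCoeff (fun x ↦ u x - H x) 0)).add hHp).congr (fun x hx ↦ ?_) (fun x _ ↦ zero_add _)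
    simp only [← hw x hx]
    ring
  have he : IsPrimitive (fun x : ℝ ↦ Complex.exp (Complex.I * μ * x))
      (fun x : ℝ ↦ Complex.I * μ * Complex.exp (Complex.I * μ * x)) := by
    refine IsPrimitive.of_hasDerivAt (fun x ↦ ?_) (by fun_prop)
    have h : HasDerivAt (fun x : ℝ ↦ Complex.I * μ * (x : ℂ)) (Complex.I * μ * 1) x :=
      ((hasDerivAt_id x).ofReal_comp).const_mul _
    exact h.cexp.congr_deriv (by ring)
  refine ⟨fun x ↦ Complex.exp (Complex.I * μ * x) * u x,
    fun x ↦ Complex.exp (Complex.I * μ * x) * (F x + c - Complex.I * μ * u x), ?_, ?_, ?_, ?_, ?_⟩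
  · refine (he.mul hup).congr (fun x _ ↦ rfl) (fun x _ ↦ ?_)
    simp only [hG]
    ring
  · refine (he.mul ((hFp.add (IsPrimitive.const c)).sub (hup.const_mul (Complex.I * μ)))).congr
      (fun x _ ↦ rfl) (fun x _ ↦ ?_)
    simp only [hG, hf]
    linear_combination Complex.exp (Complex.I * μ * x) * u x * μ ^ 2 * Complex.I_sq
  · simp [← hu01]
  · simp [← hu01, hF0, hF1]
  · by_contra! hcon
    have hz : ∀ x ∈ Set.Icc (0:ℝ) 1, u x = 0 := fun x hx ↦
      (mul_eq_zero.1 (hcon x hx)).resolve_left (Complex.exp_ne_zero _)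
    have h1 : fCoeff u 0 = fCoeff (fun _ ↦ 0) 0 := fCoeff_congr hz 0
    rw [hu0] at h1
    simp [fCoeff] at h1

theorem IsCaraSol.isPrimitive_deriv {q : ℝ → ℂ} (hq : IntervalIntegrable q volume 0 1) {lam : ℂ}
    {y : ℝ → ℂ} (hy : IsCaraSol q lam y) :
    IsPrimitive (deriv y) (fun x ↦ (q x - lam) * y x) :=
  ⟨(hq.sub (by simp)).mul_continuousOn hy.1.continuous.continuousOn, fun x _ ↦ hy.2 x⟩

theorem IsCaraSol.isPrimitive {q : ℝ → ℂ} (hq : IntervalIntegrable q volume 0 1) {lam : ℂ}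
    {y : ℝ → ℂ} (hy : IsCaraSol q lam y) : IsPrimitive y (deriv y) :=
  .of_hasDerivAt (fun x ↦ (hy.1 x).hasDerivAt) (hy.isPrimitive_deriv hq).continuousOn

/-- The Wronskian of two solutions of `y'' = p y` is constant. -/
theorem IsPrimitive.wronskian_eq {p f f' g g' : ℝ → ℂ} (hf : IsPrimitive f f')
    (hf' : IsPrimitive f' (fun x ↦ p x * f x)) (hg : IsPrimitive g g')
    (hg' : IsPrimitive g' (fun x ↦ p x * g x)) {x : ℝ} (hx : x ∈ Set.Icc (0:ℝ) 1) :
    f x * g' x - f' x * g x = f 0 * g' 0 - f' 0 * g 0 := by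
  have h : IsPrimitive (fun x ↦ f x * g' x - f' x * g x) (fun _ ↦ 0) :=
    ((hf.mul hg').sub (hf'.mul hg)).congr (fun x _ ↦ rfl) (fun x _ ↦ by ring)
  simpa using h.eq_add_integral x hx

/-- The discriminant formula when `exp (I * μ)` is the multiplier of a Floquet solution given by a
Fourier series. -/
theorem hill_discriminant_of_ne {q : ℝ → ℂ} (hq : MemL1Plus q) {μ : ℂ}
    (hμ : ∀ n : ℕ, n ≠ 0 → μ + Real.pi * n ≠ 0) {θ φ : ℝ → ℂ}
    (hθ : IsCaraSol q (μ ^ 2) θ) (hφ : IsCaraSol q (μ ^ 2) φ)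
    (hθ0 : θ 0 = 1) (hθ'0 : deriv θ 0 = 0) (hφ0 : φ 0 = 0) (hφ'0 : deriv φ 0 = 1) :
    deriv φ 1 + θ 1 = 2 * Complex.cos μ := by
  obtain ⟨y, y', hy, hy', hy1, hy'1, x, hx, hyx⟩ := exists_floquet_solution hq hμ
  have hθp := hθ.isPrimitive hq.2.1
  have hθp' := hθ.isPrimitive_deriv hq.2.1
  have hφp := hφ.isPrimitive hq.2.1
  have hφp' := hφ.isPrimitive_deriv hq.2.1
  have wθφ : ∀ x ∈ Set.Icc (0:ℝ) 1, θ x * deriv φ x - deriv θ x * φ x = 1 := fun x hx ↦ by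
    rw [hθp.wronskian_eq hθp' hφp hφp' hx, hθ0, hθ'0, hφ'0]; ring
  have wyφ : ∀ x ∈ Set.Icc (0:ℝ) 1, y x * deriv φ x - y' x * φ x = y 0 := fun x hx ↦ by
    rw [hy.wronskian_eq hy' hφp hφp' hx, hφ0, hφ'0]; ring
  have wyθ : ∀ x ∈ Set.Icc (0:ℝ) 1, y x * deriv θ x - y' x * θ x = -y' 0 := fun x hx ↦ by
    rw [hy.wronskian_eq hy' hθp hθp' hx, hθ0, hθ'0]; ring
  have hyeq : ∀ x ∈ Set.Icc (0:ℝ) 1, y x = y 0 * θ x + y' 0 * φ x := fun x hx ↦ by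
    linear_combination -y x * wθφ x hx + θ x * wyφ x hx - φ x * wyθ x hx
  have h1 : (1:ℝ) ∈ Set.Icc (0:ℝ) 1 := by simp
  have e1 := wθφ 1 h1
  have e2 := wyφ 1 h1
  have e3 := wyθ 1 h1
  rw [hy1, hy'1] at e2 e3
  set ρ := Complex.exp (Complex.I * μ) with hρ
  have hρ0 : ρ ≠ 0 := Complex.exp_ne_zero _
  have hcos : ρ * (2 * Complex.cos μ) = ρ ^ 2 + 1 := by
    have hinv : Complex.exp (-μ * Complex.I) = ρ⁻¹ := by
      rw [hρ, ← Complex.exp_neg]; congr 1; ring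
    rw [Complex.two_cos, hinv, mul_comm μ, ← hρ]
    field_simp
  have hchar : ρ ^ 2 - (deriv φ 1 + θ 1) * ρ + 1 = 0 := by
    by_contra hne
    have hA : y 0 = 0 := (mul_eq_zero.1
      (by linear_combination (ρ * θ 1 - 1) * e2 - ρ * φ 1 * e3 - ρ ^ 2 * y 0 * e1 :
        (ρ ^ 2 - (deriv φ 1 + θ 1) * ρ + 1) * y 0 = 0)).resolve_left hne
    have hB : y' 0 = 0 := (mul_eq_zero.1
      (by linear_combination ρ * deriv θ 1 * e2 - (ρ * deriv φ 1 - 1) * e3 - ρ ^ 2 * y' 0 * e1 :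
        (ρ ^ 2 - (deriv φ 1 + θ 1) * ρ + 1) * y' 0 = 0)).resolve_left hne
    exact hyx (by rw [hyeq x hx, hA, hB]; ring)
  apply mul_left_cancel₀ hρ0
  linear_combination -hchar - hcos

/-- For `q ∈ L¹₊`, the Hill discriminant satisfies `φ'(1) + θ(1) = 2 cos μ` for
every `μ ∈ ℂ`. -/
theorem hill_discriminant (q : ℝ → ℂ) (hq : MemL1Plus q) (μ : ℂ) (θ φ : ℝ → ℂ)
    (hθ : IsCaraSol q (μ ^ 2) θ) (hφ : IsCaraSol q (μ ^ 2) φ)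
    (hθ0 : θ 0 = 1) (hθ'0 : deriv θ 0 = 0)
    (hφ0 : φ 0 = 0) (hφ'0 : deriv φ 0 = 1) :
    deriv φ 1 + θ 1 = 2 * Complex.cos μ := by
  by_cases hμ : ∀ n : ℕ, n ≠ 0 → μ + Real.pi * n ≠ 0
  · exact hill_discriminant_of_ne hq hμ hθ hφ hθ0 hθ'0 hφ0 hφ'0
  · push Not at hμ
    obtain ⟨m, hm, hμm⟩ := hμ
    rw [← neg_sq] at hθ hφ
    rw [← Complex.cos_neg]
    refine hill_discriminant_of_ne hq (fun n _ h ↦ ?_) hθ hφ hθ0 hθ'0 hφ0 hφ'0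
    have h2 : (Real.pi : ℂ) * ((m + n : ℕ) : ℂ) = 0 := by
      push_cast
      linear_combination hμm + h
    rcases mul_eq_zero.1 h2 with h3 | h3
    · exact Real.pi_ne_zero (by exact_mod_cast h3)
    · have : m + n = 0 := by exact_mod_cast h3
      lia

end
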